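/- Suppose [α,γ] interval pattern embeds into [β,θ] via index set I, and let J be the complement of I. If a,b ∈ J and (a<b) is a matching of β (equivalently of θ), then β(a;b) = θ(a;b). -/

import Mathlib

noncomputable section
open scoped Classical

/-- A `(p,q)`-clan: a partial matching of `{0,…,p+q-1}` (encoded by the involution `mate`)
together with a sign (`true` = `+`, `false` = `-`) at each unmatched position, such that
`#(+) - #(-) = p - q`.  Matched positions carry the junk sign `true`. -/
structure Clan (p q : ℕ) where
  mate : Fin (p + q) → Fin (p + q)
  mate_invol : ∀ i, mate (mate i) = i
  sign : Fin (p + q) → Bool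
  sign_matched : ∀ i, mate i ≠ i → sign i = true
  plus_minus :
    (Finset.univ.filter fun i => mate i = i ∧ sign i = true).card + q
      = (Finset.univ.filter fun i => mate i = i ∧ sign i = false).card + p

namespace Clan

variable {p q r s : ℕ}

/-- position `i` carries a `+`. -/
def IsPlus (c : Clan p q) (i : Fin (p + q)) : Prop :=
  c.mate i = i ∧ c.sign i = true

/-- position `i` carries a `-`. -/
def IsMinus (c : Clan p q) (i : Fin (p + q)) : Prop :=
  c.mate i = i ∧ c.sign i = false

/-- position `i` is the left end of a matching. -/
def IsLeft (c : Clan p q) (i : Fin (p + q)) : Prop :=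
  i < c.mate i

/-- position `i` is the right end of a matching. -/
def IsRight (c : Clan p q) (i : Fin (p + q)) : Prop :=
  c.mate i < i

/-- `(i < j)` is a matching of the clan `c`. -/
def IsMatch (c : Clan p q) (i j : Fin (p + q)) : Prop :=
  i < j ∧ c.mate i = j

/-- The length `ℓ(c)` of a clan:
`ℓ(c) = Σ_{(i<j) matching} (j - i - #{matchings (s<t) with s < i < t < j})`. -/
def len (c : Clan p q) : ℤ :=
  ∑ ij ∈ Finset.univ.filter (fun ij : Fin (p + q) × Fin (p + q) => c.IsMatch ij.1 ij.2),
    (((ij.2 : ℕ) : ℤ) - ((ij.1 : ℕ) : ℤ) -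
      ((Finset.univ.filter (fun st : Fin (p + q) × Fin (p + q) =>
          c.IsMatch st.1 st.2 ∧ st.1 < ij.1 ∧ ij.1 < st.2 ∧ st.2 < ij.2)).card : ℤ))

/-- `c` and `c'` agree (same symbols, same matchings) at every position outside `S`. -/
def AgreeOutside (c c' : Clan p q) (S : Set (Fin (p + q))) : Prop :=
  ∀ i, i ∉ S → c.mate i = c'.mate i ∧ c.sign i = c'.sign i

/-- `c'` is obtained from `c` by one of the transpositions (T.1)–(T.10). -/
def Transposition (c c' : Clan p q) : Prop :=
  -- (T.1)  +- ↦ 11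
  (∃ a b, a < b ∧ c.IsPlus a ∧ c.IsMinus b ∧ c'.IsMatch a b ∧
      AgreeOutside c c' {a, b}) ∨
  -- (T.2)  -+ ↦ 11
  (∃ a b, a < b ∧ c.IsMinus a ∧ c.IsPlus b ∧ c'.IsMatch a b ∧
      AgreeOutside c c' {a, b}) ∨
  -- (T.3)  11+ ↦ 1+1
  (∃ a b d, c.IsMatch a b ∧ b < d ∧ c.IsPlus d ∧ c'.IsMatch a d ∧ c'.IsPlus b ∧
      AgreeOutside c c' {a, b, d}) ∨
  -- (T.4)  11- ↦ 1-1
  (∃ a b d, c.IsMatch a b ∧ b < d ∧ c.IsMinus d ∧ c'.IsMatch a d ∧ c'.IsMinus b ∧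
      AgreeOutside c c' {a, b, d}) ∨
  -- (T.5)  +11 ↦ 1+1
  (∃ a b d, c.IsPlus a ∧ a < b ∧ c.IsMatch b d ∧ c'.IsMatch a d ∧ c'.IsPlus b ∧
      AgreeOutside c c' {a, b, d}) ∨
  -- (T.6)  -11 ↦ 1-1
  (∃ a b d, c.IsMinus a ∧ a < b ∧ c.IsMatch b d ∧ c'.IsMatch a d ∧ c'.IsMinus b ∧
      AgreeOutside c c' {a, b, d}) ∨
  -- (T.7)  1122 ↦ 1212
  (∃ i j k l, c.IsMatch i j ∧ j < k ∧ c.IsMatch k l ∧ c'.IsMatch i k ∧ c'.IsMatch j l ∧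
      AgreeOutside c c' {i, j, k, l}) ∨
  -- (T.8)  1122 ↦ 1+-1
  (∃ i j k l, c.IsMatch i j ∧ j < k ∧ c.IsMatch k l ∧ c'.IsMatch i l ∧ c'.IsPlus j ∧
      c'.IsMinus k ∧ AgreeOutside c c' {i, j, k, l}) ∨
  -- (T.9)  1122 ↦ 1-+1
  (∃ i j k l, c.IsMatch i j ∧ j < k ∧ c.IsMatch k l ∧ c'.IsMatch i l ∧ c'.IsMinus j ∧
      c'.IsPlus k ∧ AgreeOutside c c' {i, j, k, l}) ∨
  -- (T.10) 1212 ↦ 1221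
  (∃ i j k l, i < j ∧ j < k ∧ k < l ∧ c.IsMatch i k ∧ c.IsMatch j l ∧ c'.IsMatch i l ∧
      c'.IsMatch j k ∧ AgreeOutside c c' {i, j, k, l})

/-- Bruhat order `≤` on clans: generated by transpositions. -/
def ble (c c' : Clan p q) : Prop :=
  Relation.ReflTransGen Transposition c c'

/-- Strict Bruhat order `<` on clans. -/
def blt (c c' : Clan p q) : Prop :=
  Relation.TransGen Transposition c c'

/-- Covering relation: `c ⋖ c'` iff `c < c'` and `ℓ(c') = ℓ(c) + 1`. -/
def Covers (c c' : Clan p q) : Prop :=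
  blt c c' ∧ c'.len = c.len + 1

/-- `θ` pattern contains `γ` via the strictly increasing index map `ι`. -/
def Pattern (θ : Clan r s) (γ : Clan p q) (ι : Fin (p + q) → Fin (r + s)) : Prop :=
  StrictMono ι ∧
  (∀ j, γ.mate j = j → θ.mate (ι j) = ι j ∧ θ.sign (ι j) = γ.sign j) ∧
  (∀ k l, γ.IsMatch k l → θ.IsMatch (ι k) (ι l))

/-- `φ` agrees with `θ` at every position outside the range of `ι`. -/
def AgreesWithOutside (φ θ : Clan r s) (ι : Fin (p + q) → Fin (r + s)) : Prop :=
  ∀ m, (∀ k, ι k ≠ m) → φ.mate m = θ.mate m ∧ φ.sign m = θ.sign m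

/-- `[α,γ]` interval pattern embeds into `[β,θ]` via `ι`. -/
def IntervalEmbed (α γ : Clan p q) (β θ : Clan r s)
    (ι : Fin (p + q) → Fin (r + s)) : Prop :=
  Pattern θ γ ι ∧ Pattern β α ι ∧ AgreesWithOutside β θ ι ∧
  θ.len - β.len = γ.len - α.len

/-- `θ` interval pattern contains `[α,γ]`. -/
def IntervalContains (θ : Clan r s) (α γ : Clan p q) : Prop :=
  ∃ (ι : Fin (p + q) → Fin (r + s)) (φ : Clan r s), IntervalEmbed α γ φ θ ι

/-- `γ(i;+)` (here `i` is the number of initial positions considered, i.e. `i` is 1-indexed):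
number of `+`'s plus number of matchings entirely among the first `i` positions. -/
def statPlus (c : Clan p q) (i : ℕ) : ℕ :=
  (Finset.univ.filter fun j : Fin (p + q) => (j : ℕ) < i ∧ c.IsPlus j).card +
  (Finset.univ.filter fun ab : Fin (p + q) × Fin (p + q) =>
      c.IsMatch ab.1 ab.2 ∧ (ab.2 : ℕ) < i).card

/-- `γ(i;-)`, as in `statPlus` with `-`'s. -/
def statMinus (c : Clan p q) (i : ℕ) : ℕ :=
  (Finset.univ.filter fun j : Fin (p + q) => (j : ℕ) < i ∧ c.IsMinus j).card +
  (Finset.univ.filter fun ab : Fin (p + q) × Fin (p + q) =>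
      c.IsMatch ab.1 ab.2 ∧ (ab.2 : ℕ) < i).card

/-- `γ(i;j)` (with `i < j` 1-indexed): number of matchings with left endpoint weakly left
of `i` and right endpoint strictly right of `j`. -/
def statMid (c : Clan p q) (i j : ℕ) : ℕ :=
  (Finset.univ.filter fun ab : Fin (p + q) × Fin (p + q) =>
      c.IsMatch ab.1 ab.2 ∧ (ab.1 : ℕ) < i ∧ j ≤ (ab.2 : ℕ)).card

/-- The permutation `w_c` associated to a clan `c`, 0-indexed: positions carrying a `+` or a
left endpoint get (in left-to-right order) the values `0,…,p-1`; the remaining values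
`p,…,p+q-1` are assigned, scanning left to right, to each `-` as it is encountered and to the
right end of each matching as soon as its left end is encountered. -/
def wNat (c : Clan p q) (i : Fin (p + q)) : ℕ :=
  if c.IsPlus i ∨ c.IsLeft i then
    (Finset.univ.filter fun j : Fin (p + q) => (c.IsPlus j ∨ c.IsLeft j) ∧ j < i).card
  else
    p + (Finset.univ.filter fun j : Fin (p + q) =>
        (c.IsMinus j ∨ c.IsLeft j) ∧ j < (if c.IsMinus i then i else c.mate i)).card

/-- Membership in the affine space `S_c`: the conditions (O.1)–(O.3) and (Z.1)–(Z.9). -/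
def MemS (c : Clan p q) (M : Matrix (Fin (p + q)) (Fin (p + q)) ℂ) : Prop :=
  -- (O.1)
  (∀ i j : Fin (p + q), c.mate i = i → (j : ℕ) = c.wNat i → M i j = 1) ∧
  -- (O.2)
  (∀ i i' j : Fin (p + q), c.IsMatch i i' →
      ((j : ℕ) = c.wNat i ∨ (j : ℕ) = c.wNat i') → M i j = 1) ∧
  -- (O.3)
  (∀ i i' j : Fin (p + q), c.IsMatch i i' → (j : ℕ) = c.wNat i → M i' j = -1) ∧
  (∀ i i' j : Fin (p + q), c.IsMatch i i' → (j : ℕ) = c.wNat i' → M i' j = 1) ∧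
  -- (Z.1): first p columns, rows containing a pivot (rows of +'s and of left endpoints)
  (∀ i j : Fin (p + q), (c.IsPlus i ∨ c.IsLeft i) → (j : ℕ) < p →
      (j : ℕ) ≠ c.wNat i → M i j = 0) ∧
  -- (Z.2): above a pivot, first p columns
  (∀ i x j : Fin (p + q), (c.IsPlus i ∨ c.IsLeft i) → (j : ℕ) = c.wNat i →
      x < i → M x j = 0) ∧
  -- (Z.3): between the pivot 1 and the -1 of a column
  (∀ i i' x j : Fin (p + q), c.IsMatch i i' → (j : ℕ) = c.wNat i →
      i < x → x < i' → M x j = 0) ∧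
  -- (Z.4): right of a -1, within the first p columns
  (∀ i i' j : Fin (p + q), c.IsMatch i i' → c.wNat i < (j : ℕ) → (j : ℕ) < p →
      M i' j = 0) ∧
  -- (Z.5): last q columns, rows containing a pivot (rows of -'s and of left endpoints)
  (∀ i j : Fin (p + q), c.IsMinus i → p ≤ (j : ℕ) → (j : ℕ) ≠ c.wNat i → M i j = 0) ∧
  (∀ i i' j : Fin (p + q), c.IsMatch i i' → p ≤ (j : ℕ) → (j : ℕ) ≠ c.wNat i' →
      M i j = 0) ∧
  -- (Z.6): above a pivot, last q columns
  (∀ i x j : Fin (p + q), c.IsMinus i → (j : ℕ) = c.wNat i → x < i → M x j = 0) ∧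
  (∀ i i' x j : Fin (p + q), c.IsMatch i i' → (j : ℕ) = c.wNat i' → x < i → M x j = 0) ∧
  -- (Z.7): between the pivot 1 and the second 1 of a column
  (∀ i i' x j : Fin (p + q), c.IsMatch i i' → (j : ℕ) = c.wNat i' →
      i < x → x < i' → M x j = 0) ∧
  -- (Z.8): right of a second-1-of-its-column
  (∀ i i' j : Fin (p + q), c.IsMatch i i' → c.wNat i' < (j : ℕ) → M i' j = 0) ∧
  -- (Z.9): identification for 1212 patterns
  (∀ i j k l ci ck : Fin (p + q), c.IsMatch i k → c.IsMatch j l →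
      i < j → j < k → k < l → (ci : ℕ) = c.wNat i → (ck : ℕ) = c.wNat k →
      M l ck = - M l ci)

/-- Rank of the southwest `(n-i) × p` submatrix of `M` (`i` 1-indexed from `1` to `n`). -/
def swRank (p q : ℕ) (M : Matrix (Fin (p + q)) (Fin (p + q)) ℂ) (i : ℕ) : ℕ :=
  Matrix.rank (Matrix.of fun (x : Fin (p + q - i)) (y : Fin p) =>
    M ⟨i + (x : ℕ), by have := x.isLt; omega⟩ ⟨(y : ℕ), by have := y.isLt; omega⟩)

/-- Rank of the southeast `(n-i) × q` submatrix of `M`. -/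
def seRank (p q : ℕ) (M : Matrix (Fin (p + q)) (Fin (p + q)) ℂ) (i : ℕ) : ℕ :=
  Matrix.rank (Matrix.of fun (x : Fin (p + q - i)) (y : Fin q) =>
    M ⟨i + (x : ℕ), by have := x.isLt; omega⟩ ⟨p + (y : ℕ), by have := y.isLt; omega⟩)

/-- Rank of the auxiliary matrix `M^{[i;j]}`: its first `i` columns are the first `i` columns
of `M⁻¹` with the last `q` rows zeroed out, its last `j` columns are the first `j` columns
of `M⁻¹`. -/
def auxRank (p q : ℕ) (M : Matrix (Fin (p + q)) (Fin (p + q)) ℂ) (i j : ℕ) : ℕ :=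
  Matrix.rank (Matrix.of fun (x : Fin (p + q)) (y : Fin i ⊕ Fin j) =>
    Sum.elim
      (fun a : Fin i =>
        if p ≤ (x : ℕ) then (0 : ℂ)
        else if h : (a : ℕ) < p + q then M⁻¹ x ⟨(a : ℕ), h⟩ else 0)
      (fun b : Fin j =>
        if h : (b : ℕ) < p + q then M⁻¹ x ⟨(b : ℕ), h⟩ else 0) y)

/-- The Mars–Springer variety `N_{θ,c}`: matrices of `S_c` satisfying the rank
conditions (R.1)–(R.3) attached to `θ`. -/
def MarsSpringer (θ c : Clan p q) (M : Matrix (Fin (p + q)) (Fin (p + q)) ℂ) : Prop :=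
  MemS c M ∧
  (∀ i : ℕ, 1 ≤ i → i ≤ p + q → swRank p q M i ≤ p - statPlus θ i) ∧
  (∀ i : ℕ, 1 ≤ i → i ≤ p + q → seRank p q M i ≤ q - statMinus θ i) ∧
  (∀ i j : ℕ, 1 ≤ i → i < j → j ≤ p + q → auxRank p q M i j ≤ j + statMid θ i j)

/-- The linear relations defining the coordinates `λ_{k,a}`:
`e_k + Σ_{a ≥ p} λ_{k,a} v_a = Σ_{a < p} λ_{k,a} v_a`, where `v_a` are the columns of `M`. -/
def LambdaRel (p q : ℕ) (M : Matrix (Fin (p + q)) (Fin (p + q)) ℂ)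
    (lam : Fin (p + q) → Fin (p + q) → ℂ) : Prop :=
  ∀ k x : Fin (p + q),
    (if x = k then (1 : ℂ) else 0) +
        ∑ a ∈ Finset.univ.filter (fun a : Fin (p + q) => p ≤ (a : ℕ)), lam k a * M x a
      = ∑ a ∈ Finset.univ.filter (fun a : Fin (p + q) => (a : ℕ) < p), lam k a * M x a

/-- The base point of `S_c`: all free entries set to `0`. -/
def basePoint (c : Clan p q) : Matrix (Fin (p + q)) (Fin (p + q)) ℂ :=
  Matrix.of fun i j =>
    if (j : ℕ) = c.wNat i then 1
    else if c.mate i ≠ i ∧ (j : ℕ) = c.wNat (c.mate i) then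
      (if c.mate i < i then -1 else 1)
    else 0

/-- The diagonal matrix `I_{p,q}` with `p` ones followed by `q` negative ones. -/
def Ipq (p q : ℕ) : Matrix (Fin (p + q)) (Fin (p + q)) ℂ :=
  Matrix.diagonal fun i => if (i : ℕ) < p then 1 else -1

end Clan

namespace Clan

/-- Matchings are counted by their left ends. -/
lemma sum_isMatch {p q : ℕ} {M : Type*} [AddCommMonoid M] (c : Clan p q)
    (P : Fin (p + q) → Fin (p + q) → Prop) [∀ x y, Decidable (P x y)]
    (f : Fin (p + q) × Fin (p + q) → M) :
    ∑ ab ∈ Finset.univ.filter (fun ab : Fin (p + q) × Fin (p + q) =>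
        c.IsMatch ab.1 ab.2 ∧ P ab.1 ab.2), f ab
      = ∑ x, if x < c.mate x ∧ P x (c.mate x) then f (x, c.mate x) else 0 := by
  rw [Finset.sum_filter, Fintype.sum_prod_type]
  refine Finset.sum_congr rfl fun x _ => ?_
  rw [Finset.sum_eq_single (c.mate x)]
  · simp [IsMatch]
  · intro y _ hy
    exact if_neg fun h => hy h.1.2.symm
  · simp

lemma statMid_eq_sum {p q : ℕ} (c : Clan p q) {i j : ℕ} (hij : i ≤ j) :
    c.statMid i j
      = ∑ x : Fin (p + q), if (x : ℕ) < i ∧ j ≤ (c.mate x : ℕ) then 1 else 0 := by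
  rw [statMid, Finset.card_eq_sum_ones,
    sum_isMatch c (fun x y => (x : ℕ) < i ∧ j ≤ (y : ℕ)) (fun _ => 1)]
  refine Finset.sum_congr rfl fun x _ => if_congr ?_ rfl rfl
  rw [Fin.lt_def]
  omega

lemma len_eq_sum {p q : ℕ} (c : Clan p q) :
    c.len = ∑ x : Fin (p + q), if x < c.mate x then
      (((c.mate x : ℕ) : ℤ) - ((x : ℕ) : ℤ)
        - ∑ s, if s < x ∧ x < c.mate s ∧ c.mate s < c.mate x then (1 : ℤ) else 0) else 0 := by
  have h := sum_isMatch c (fun _ _ => True) (fun ij : Fin (p + q) × Fin (p + q) =>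
    (((ij.2 : ℕ) : ℤ) - ((ij.1 : ℕ) : ℤ) -
      ((Finset.univ.filter (fun st : Fin (p + q) × Fin (p + q) =>
          c.IsMatch st.1 st.2 ∧ st.1 < ij.1 ∧ ij.1 < st.2 ∧ st.2 < ij.2)).card : ℤ)))
  simp only [and_true] at h
  rw [len, h]
  refine Finset.sum_congr rfl fun x _ => ?_
  congr 2
  rw [Finset.card_eq_sum_ones, Nat.cast_sum, sum_isMatch c
    (fun s t => s < x ∧ x < t ∧ t < c.mate x)]
  refine Finset.sum_congr rfl fun s _ => ?_
  have : (s < c.mate s ∧ s < x ∧ x < c.mate s ∧ c.mate s < c.mate x) ↔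
      (s < x ∧ x < c.mate s ∧ c.mate s < c.mate x) :=
    ⟨fun h => h.2, fun h => ⟨h.1.trans h.2.1, h⟩⟩
  simp [this]

lemma statMid_le_of_agreeOutside {p q : ℕ} {c c' : Clan p q} {i j : ℕ} (hij : i ≤ j)
    (S : Finset (Fin (p + q))) (h : AgreeOutside c c' (S : Set (Fin (p + q))))
    (hS : (∑ x ∈ S, if (x : ℕ) < i ∧ j ≤ (c.mate x : ℕ) then 1 else 0)
      ≤ ∑ x ∈ S, if (x : ℕ) < i ∧ j ≤ (c'.mate x : ℕ) then 1 else 0) :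
    c.statMid i j ≤ c'.statMid i j := by
  rw [statMid_eq_sum c hij, statMid_eq_sum c' hij, ← Finset.sum_add_sum_compl S,
    ← Finset.sum_add_sum_compl S (fun x => if (x : ℕ) < i ∧ j ≤ (c'.mate x : ℕ) then 1 else 0)]
  refine add_le_add hS (le_of_eq (Finset.sum_congr rfl fun x hx => ?_))
  rw [(h x (by simpa using hx)).1]

lemma IsMatch.mate_right {p q : ℕ} {c : Clan p q} {a b : Fin (p + q)} (h : c.IsMatch a b) :
    c.mate b = a := by
  rw [← h.2, c.mate_invol]

lemma statMid_le_of_pair {p q : ℕ} {c c' : Clan p q} {i j : ℕ} (hij : i ≤ j)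
    {a b : Fin (p + q)} (hab : a < b) (ha : c.mate a = a) (hb : c.mate b = b)
    (h : AgreeOutside c c' {a, b}) : c.statMid i j ≤ c'.statMid i j := by
  refine statMid_le_of_agreeOutside hij {a, b} (by simpa using h) ?_
  rw [Finset.sum_pair hab.ne, Finset.sum_pair hab.ne, ha, hb]
  split_ifs <;> omega

lemma statMid_le_of_triple {p q : ℕ} {c c' : Clan p q} {i j : ℕ} (hij : i ≤ j)
    {a b d : Fin (p + q)} (hab : a < b) (hbd : b < d)
    (hc : c.IsMatch a b ∧ c.mate d = d ∨ c.mate a = a ∧ c.IsMatch b d)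
    (hd : c'.IsMatch a d) (h : AgreeOutside c c' {a, b, d}) :
    c.statMid i j ≤ c'.statMid i j := by
  have h1 : a ∉ ({b, d} : Finset (Fin (p + q))) := by
    simp [hab.ne, (hab.trans hbd).ne]
  refine statMid_le_of_agreeOutside hij {a, b, d} (by simpa using h) ?_
  rw [Finset.sum_insert h1, Finset.sum_insert h1, Finset.sum_pair hbd.ne, Finset.sum_pair hbd.ne,
    hd.2, hd.mate_right]
  rw [Fin.lt_def] at hab hbd
  rcases hc with ⟨hm, hf⟩ | ⟨hf, hm⟩ <;> rw [hm.2, hm.mate_right, hf] <;> split_ifs <;> omega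

lemma statMid_le_of_quadruple {p q : ℕ} {c c' : Clan p q} {i j : ℕ} (hij : i ≤ j)
    {a b d e : Fin (p + q)} (hab : a < b) (hbd : b < d) (hde : d < e)
    (hc : c.IsMatch a b ∧ c.IsMatch d e ∧
        (c'.IsMatch a d ∧ c'.IsMatch b e ∨ c'.IsMatch a e) ∨
      c.IsMatch a d ∧ c.IsMatch b e ∧ c'.IsMatch a e ∧ c'.IsMatch b d)
    (h : AgreeOutside c c' {a, b, d, e}) :
    c.statMid i j ≤ c'.statMid i j := by
  have h1 : a ∉ ({b, d, e} : Finset (Fin (p + q))) := by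
    simp [hab.ne, (hab.trans hbd).ne, (hab.trans (hbd.trans hde)).ne]
  have h2 : b ∉ ({d, e} : Finset (Fin (p + q))) := by
    simp [hbd.ne, (hbd.trans hde).ne]
  refine statMid_le_of_agreeOutside hij {a, b, d, e} (by simpa using h) ?_
  rw [Finset.sum_insert h1, Finset.sum_insert h1, Finset.sum_insert h2, Finset.sum_insert h2,
    Finset.sum_pair hde.ne, Finset.sum_pair hde.ne]
  rw [Fin.lt_def] at hab hbd hde
  rcases hc with ⟨hm, hn, ⟨hm', hn'⟩ | hm'⟩ | ⟨hm, hn, hm', hn'⟩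
  · rw [hm.2, hm.mate_right, hn.2, hn.mate_right, hm'.2, hm'.mate_right, hn'.2, hn'.mate_right]
    split_ifs <;> omega
  · rw [hm.2, hm.mate_right, hn.2, hn.mate_right, hm'.2, hm'.mate_right]
    split_ifs <;> omega
  · rw [hm.2, hm.mate_right, hn.2, hn.mate_right, hm'.2, hm'.mate_right, hn'.2, hn'.mate_right]
    split_ifs <;> omega

lemma Transposition.statMid_le {p q : ℕ} {c c' : Clan p q} (h : Transposition c c') {i j : ℕ}
    (hij : i ≤ j) : c.statMid i j ≤ c'.statMid i j := by
  rcases h with ⟨a, b, hab, ha, hb, -, h⟩ | ⟨a, b, hab, ha, hb, -, h⟩ |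
    ⟨a, b, d, hab, hbd, hd, had, -, h⟩ | ⟨a, b, d, hab, hbd, hd, had, -, h⟩ |
    ⟨a, b, d, ha, hab, hbd, had, -, h⟩ | ⟨a, b, d, ha, hab, hbd, had, -, h⟩ |
    ⟨a, b, d, e, hab, hbd, hde, had, hbe, h⟩ | ⟨a, b, d, e, hab, hbd, hde, hae, -, -, h⟩ |
    ⟨a, b, d, e, hab, hbd, hde, hae, -, -, h⟩ |
    ⟨a, b, d, e, hab, hbd, hde, had, hbe, hae, hbd', h⟩
  · exact statMid_le_of_pair hij hab ha.1 hb.1 h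
  · exact statMid_le_of_pair hij hab ha.1 hb.1 h
  · exact statMid_le_of_triple hij hab.1 hbd (Or.inl ⟨hab, hd.1⟩) had h
  · exact statMid_le_of_triple hij hab.1 hbd (Or.inl ⟨hab, hd.1⟩) had h
  · exact statMid_le_of_triple hij hab hbd.1 (Or.inr ⟨ha.1, hbd⟩) had h
  · exact statMid_le_of_triple hij hab hbd.1 (Or.inr ⟨ha.1, hbd⟩) had h
  · exact statMid_le_of_quadruple hij hab.1 hbd hde.1 (Or.inl ⟨hab, hde, Or.inl ⟨had, hbe⟩⟩) h
  · exact statMid_le_of_quadruple hij hab.1 hbd hde.1 (Or.inl ⟨hab, hde, Or.inr hae⟩) h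
  · exact statMid_le_of_quadruple hij hab.1 hbd hde.1 (Or.inl ⟨hab, hde, Or.inr hae⟩) h
  · exact statMid_le_of_quadruple hij hab hbd hde (Or.inr ⟨had, hbe, hae, hbd'⟩) h

lemma ble.statMid_le {p q : ℕ} {c c' : Clan p q} (h : ble c c') {i j : ℕ} (hij : i ≤ j) :
    c.statMid i j ≤ c'.statMid i j := by
  induction h with
  | refl => exact le_rfl
  | tail _ h ih => exact ih.trans (h.statMid_le hij)

/-- The positions outside the range of an index map. -/
def offRange {m n : ℕ} (ι : Fin m → Fin n) : Finset (Fin n) :=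
  Finset.univ.filter fun z => ∀ k, ι k ≠ z

lemma mem_offRange {m n : ℕ} {ι : Fin m → Fin n} {z : Fin n} :
    z ∈ offRange ι ↔ ∀ k, ι k ≠ z := by
  simp [offRange]

lemma sum_eq_sum_range_add_sum_offRange {m n : ℕ} {M : Type*} [AddCommMonoid M]
    {ι : Fin m → Fin n} (hι : StrictMono ι) (f : Fin n → M) :
    ∑ x, f x = ∑ k, f (ι k) + ∑ z ∈ offRange ι, f z := by
  rw [← Finset.sum_add_sum_compl (Finset.univ.image ι),
    Finset.sum_image fun x _ y _ h => hι.injective h]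
  congr 2
  ext z
  simp [mem_offRange]

lemma sum_ite_between {n : ℕ} {x y : Fin n} (h : x < y) :
    (∑ z, if x < z ∧ z < y then (1 : ℤ) else 0) = (y : ℤ) - (x : ℤ) - 1 := by
  have : (Finset.univ.filter fun z => x < z ∧ z < y) = Finset.Ioo x y := by
    ext z
    simp
  rw [Finset.sum_boole, this, Fin.card_Ioo]
  rw [Fin.lt_def] at h
  omega

lemma gap_eq {m n : ℕ} {ι : Fin m → Fin n} (hι : StrictMono ι) {k l : Fin m} (h : k < l) :
    ((ι l : ℕ) : ℤ) - ((ι k : ℕ) : ℤ) = ((l : ℕ) : ℤ) - ((k : ℕ) : ℤ)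
      + ∑ z ∈ offRange ι, if ι k < z ∧ z < ι l then (1 : ℤ) else 0 := by
  have h1 := sum_ite_between (hι h)
  rw [sum_eq_sum_range_add_sum_offRange hι] at h1
  simp only [hι.lt_iff_lt] at h1
  rw [sum_ite_between h] at h1
  linarith

lemma Pattern.mate_apply {p q r s : ℕ} {θ : Clan r s} {γ : Clan p q}
    {ι : Fin (p + q) → Fin (r + s)} (h : Pattern θ γ ι) (k : Fin (p + q)) :
    θ.mate (ι k) = ι (γ.mate k) := by
  rcases lt_trichotomy k (γ.mate k) with hk | hk | hk
  · exact (h.2.2 k _ ⟨hk, rfl⟩).2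
  · rw [← hk]
    exact (h.2.1 k hk.symm).1
  · exact (h.2.2 (γ.mate k) k ⟨hk, γ.mate_invol k⟩).mate_right

lemma Pattern.mate_mem_offRange {p q r s : ℕ} {θ : Clan r s} {γ : Clan p q}
    {ι : Fin (p + q) → Fin (r + s)} (h : Pattern θ γ ι) {z : Fin (r + s)}
    (hz : z ∈ offRange ι) : θ.mate z ∈ offRange ι := by
  rw [mem_offRange] at hz ⊢
  intro k hk
  refine hz (γ.mate k) ?_
  rw [← h.mate_apply, hk, θ.mate_invol]

/-- The contribution to the length of the matchings among the positions outside the range. -/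
def lenOff {m r s : ℕ} (θ : Clan r s) (ι : Fin m → Fin (r + s)) : ℤ :=
  ∑ z ∈ offRange ι, if z < θ.mate z then
    (((θ.mate z : ℕ) : ℤ) - ((z : ℕ) : ℤ) - ∑ s ∈ offRange ι,
      if s < z ∧ z < θ.mate s ∧ θ.mate s < θ.mate z then (1 : ℤ) else 0) else 0

/-- The number of embedded matchings covering both `z` and its mate. -/
def coverCount {p q r s : ℕ} (θ : Clan r s) (γ : Clan p q)
    (ι : Fin (p + q) → Fin (r + s)) (z : Fin (r + s)) : ℤ :=
  ∑ k, if (ι k < z ∧ z < ι (γ.mate k)) ∧ ι k < θ.mate z ∧ θ.mate z < ι (γ.mate k)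
    then (1 : ℤ) else 0

lemma coverCount_eq {p q r s : ℕ} {θ : Clan r s} {γ : Clan p q}
    {ι : Fin (p + q) → Fin (r + s)} (h : Pattern θ γ ι) {z : Fin (r + s)}
    (hz : z ∈ offRange ι) :
    coverCount θ γ ι z
      = (∑ k, if ι k < z ∧ z < ι (γ.mate k) then (1 : ℤ) else 0)
        - (∑ k, if ι k < z ∧ z < ι (γ.mate k) ∧ ι (γ.mate k) < θ.mate z then (1 : ℤ) else 0)
        - ∑ k, if θ.mate z < ι k ∧ ι k < z ∧ z < ι (γ.mate k) then (1 : ℤ) else 0 := by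
  have hz' := mem_offRange.1 (h.mate_mem_offRange hz)
  rw [coverCount, ← Finset.sum_sub_distrib, ← Finset.sum_sub_distrib]
  refine Finset.sum_congr rfl fun k _ => ?_
  have h1 := Fin.val_ne_of_ne (hz' k)
  have h2 := Fin.val_ne_of_ne (hz' (γ.mate k))
  simp only [Fin.lt_def]
  split_ifs <;> omega

lemma Pattern.len_eq {p q r s : ℕ} {θ : Clan r s} {γ : Clan p q}
    {ι : Fin (p + q) → Fin (r + s)} (h : Pattern θ γ ι) :
    θ.len = γ.len + lenOff θ ι + ∑ z ∈ offRange ι, coverCount θ γ ι z := by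
  have hι := h.1
  have hin : (∑ k, if ι k < θ.mate (ι k) then
      (((θ.mate (ι k) : ℕ) : ℤ) - ((ι k : ℕ) : ℤ) - ∑ s,
        if s < ι k ∧ ι k < θ.mate s ∧ θ.mate s < θ.mate (ι k) then (1 : ℤ) else 0) else 0)
      = γ.len + ∑ z ∈ offRange ι, ((∑ k, if ι k < z ∧ z < ι (γ.mate k) then (1 : ℤ) else 0)
        - ∑ k, if z < ι k ∧ ι k < θ.mate z ∧ θ.mate z < ι (γ.mate k) then (1 : ℤ) else 0) := by
    simp only [← Finset.sum_sub_distrib]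
    rw [len_eq_sum γ, Finset.sum_comm, ← Finset.sum_add_distrib]
    refine Finset.sum_congr rfl fun k _ => ?_
    rw [sum_eq_sum_range_add_sum_offRange hι]
    simp only [h.mate_apply, hι.lt_iff_lt]
    rw [Finset.sum_sub_distrib]
    split_ifs with hk
    · rw [gap_eq hι hk]
      ring
    · have hk' := hι.monotone (not_lt.1 hk)
      rw [Finset.sum_eq_zero, Finset.sum_eq_zero]
      · simp
      · intro z _
        rw [if_neg fun hz => absurd hk' (not_le.2 (hz.2.1.trans hz.2.2))]
      · intro z _
        rw [if_neg fun hz => absurd hk' (not_le.2 (hz.1.trans hz.2))]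
  have hout : (∑ z ∈ offRange ι, if z < θ.mate z then
      (((θ.mate z : ℕ) : ℤ) - ((z : ℕ) : ℤ) - ∑ s,
        if s < z ∧ z < θ.mate s ∧ θ.mate s < θ.mate z then (1 : ℤ) else 0) else 0)
      = lenOff θ ι - ∑ z ∈ offRange ι,
        ∑ k, if ι k < z ∧ z < ι (γ.mate k) ∧ ι (γ.mate k) < θ.mate z then (1 : ℤ) else 0 := by
    rw [lenOff, ← Finset.sum_sub_distrib]
    refine Finset.sum_congr rfl fun z _ => ?_
    rw [sum_eq_sum_range_add_sum_offRange hι]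
    simp only [h.mate_apply]
    split_ifs with hz
    · ring
    · rw [Finset.sum_eq_zero]
      · simp
      · intro k _
        rw [if_neg fun hk => hz (hk.2.1.trans hk.2.2)]
  have hswap : (∑ z ∈ offRange ι,
        ∑ k, if z < ι k ∧ ι k < θ.mate z ∧ θ.mate z < ι (γ.mate k) then (1 : ℤ) else 0)
      = ∑ z ∈ offRange ι,
        ∑ k, if θ.mate z < ι k ∧ ι k < z ∧ z < ι (γ.mate k) then (1 : ℤ) else 0 := by
    refine Finset.sum_nbij' θ.mate θ.mate (fun z hz => h.mate_mem_offRange hz)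
      (fun z hz => h.mate_mem_offRange hz) (fun z _ => θ.mate_invol z)
      (fun z _ => θ.mate_invol z) fun z _ => ?_
    rw [θ.mate_invol]
  rw [len_eq_sum θ, sum_eq_sum_range_add_sum_offRange hι, hin, hout,
    Finset.sum_congr rfl fun z hz => coverCount_eq h hz]
  simp only [Finset.sum_sub_distrib]
  rw [hswap]
  ring

/-- The number of matchings outside the range that cover both `z` and its mate. -/
def coverOff {m r s : ℕ} (θ : Clan r s) (ι : Fin m → Fin (r + s)) (z : Fin (r + s)) : ℤ :=
  ∑ x ∈ offRange ι, if (x < z ∧ z < θ.mate x) ∧ x < θ.mate z ∧ θ.mate z < θ.mate x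
    then (1 : ℤ) else 0

lemma Pattern.statMid_eq {p q r s : ℕ} {θ : Clan r s} {γ : Clan p q}
    {ι : Fin (p + q) → Fin (r + s)} (h : Pattern θ γ ι) {z : Fin (r + s)} :
    (θ.statMid (min (z : ℕ) (θ.mate z) + 1) (max (z : ℕ) (θ.mate z) + 1) : ℤ)
      = coverCount θ γ ι z + coverOff θ ι z := by
  have hsum : (θ.statMid (min (z : ℕ) (θ.mate z) + 1) (max (z : ℕ) (θ.mate z) + 1) : ℤ)
      = ∑ x, if (x < z ∧ z < θ.mate x) ∧ x < θ.mate z ∧ θ.mate z < θ.mate x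
          then (1 : ℤ) else 0 := by
    rw [statMid_eq_sum θ (by omega), Nat.cast_sum]
    refine Finset.sum_congr rfl fun x _ => ?_
    rw [Nat.cast_ite, Nat.cast_one, Nat.cast_zero]
    refine if_congr ?_ rfl rfl
    have h1 : x = z → θ.mate x = θ.mate z := fun e => by rw [e]
    have h2 : x = θ.mate z → θ.mate x = z := fun e => by rw [e, θ.mate_invol]
    simp only [Fin.lt_def, Fin.ext_iff] at h1 h2 ⊢
    omega
  rw [hsum, sum_eq_sum_range_add_sum_offRange h.1, coverCount, coverOff]
  simp only [h.mate_apply]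

end Clan

/-- in an interval pattern embedding `[α,γ] ↪ [β,θ]` via `ι`, for a matching
`(a<b)` of `β` with both ends outside the index set, `β(a;b) = θ(a;b)`. -/
theorem stat_mid_agree {p q r s : ℕ} (α γ : Clan p q) (β θ : Clan r s)
    (ι : Fin (p + q) → Fin (r + s))
    (hαγ : Clan.ble α γ) (hβθ : Clan.ble β θ)
    (hemb : Clan.IntervalEmbed α γ β θ ι)
    (a b : Fin (r + s)) (ha : ∀ k, ι k ≠ a) (hb : ∀ k, ι k ≠ b)
    (hm : β.IsMatch a b) :
    Clan.statMid β ((a : ℕ) + 1) ((b : ℕ) + 1)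
      = Clan.statMid θ ((a : ℕ) + 1) ((b : ℕ) + 1) := by
  obtain ⟨hθ, hβ, hag, hlen⟩ := hemb
  have hmate : ∀ z ∈ Clan.offRange ι, β.mate z = θ.mate z := fun z hz =>
    (hag z (Clan.mem_offRange.1 hz)).1
  have hoff : Clan.lenOff β ι = Clan.lenOff θ ι := by
    refine Finset.sum_congr rfl fun z hz => ?_
    rw [hmate z hz]
    refine if_congr Iff.rfl (congrArg _ (Finset.sum_congr rfl fun x hx => ?_)) rfl
    rw [hmate x hx]
  have hcov : ∀ z ∈ Clan.offRange ι, Clan.coverOff β ι z = Clan.coverOff θ ι z := by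
    refine fun z hz => Finset.sum_congr rfl fun x hx => ?_
    rw [hmate z hz, hmate x hx]
  have hle : ∀ z ∈ Clan.offRange ι, Clan.coverCount β α ι z ≤ Clan.coverCount θ γ ι z := by
    intro z hz
    have h1 := hβ.statMid_eq (z := z)
    have h2 := hθ.statMid_eq (z := z)
    rw [hmate z hz, hcov z hz] at h1
    have h3 := hβθ.statMid_le (i := min (z : ℕ) (θ.mate z) + 1)
      (j := max (z : ℕ) (θ.mate z) + 1) (by omega)
    omega
  have hsum : ∑ z ∈ Clan.offRange ι, Clan.coverCount β α ι z
      = ∑ z ∈ Clan.offRange ι, Clan.coverCount θ γ ι z := by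
    have h1 := hβ.len_eq
    have h2 := hθ.len_eq
    omega
  have hmem : a ∈ Clan.offRange ι := Clan.mem_offRange.2 ha
  have heq := (Finset.sum_eq_sum_iff_of_le hle).1 hsum a hmem
  have h1 := hβ.statMid_eq (z := a)
  have h2 := hθ.statMid_eq (z := a)
  have hab : (a : ℕ) < b := hm.1
  rw [hcov a hmem, heq, hm.2, ← h2, ← hmate a hmem, hm.2, min_eq_left hab.le,
    max_eq_right hab.le] at h1
  exact_mod_cast h1
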